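/- arXiv:0907.2710 — 6 statements merged into one kernel-verified Lean document; each statement's English description precedes it below -/
import Mathlib

section
/- Let A be an abelian group which is torsion-free and such that every additive homomorphism from ℚ to A is zero (e.g. A = ℤ). If f : ℕ → A satisfies Ω(Ω(f)) = 0, then Ω(f) = 0. (Equivalently: identifying f with a formal power series with coefficients in A, if (1+U)·d/dU applied twice to f gives 0, then (1+U)·df/dU = 0.) -/
/-- The operator on sequences `ℕ → A` corresponding to `f ↦ (1+U)·df/dU`
on formal power series `A[[U]]` with coefficients in an abelian group `A`. -/
def OmegaOp {A : Type*} [AddCommGroup A] (a : ℕ → A) : ℕ → A :=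
  fun n => (n + 1) • a (n + 1) + n • a n

/-- In a torsion-free abelian group, an element divisible by every positive integer is the image
of `1` under a homomorphism from `ℚ`. -/
theorem exists_addMonoidHom_rat_of_divisible {A : Type*} [AddCommGroup A] [IsAddTorsionFree A]
    {c : A} (hc : ∀ n : ℕ, n ≠ 0 → ∃ d : A, n • d = c) : ∃ φ : ℚ →+ A, φ 1 = c := by
  choose! d hd using hc
  have hden : ∀ q : ℚ, (q.den : ℤ) • q.num • d q.den = q.num • c := fun q => by
    rw [smul_comm, natCast_zsmul, hd _ q.den_nz]
  refine ⟨AddMonoidHom.mk' (fun q => q.num • d q.den) fun a b => ?_, ?_⟩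
  · have hne : (((a + b).den * a.den * b.den : ℕ) : ℤ) ≠ 0 :=
      mod_cast mul_ne_zero (mul_ne_zero (a + b).den_nz a.den_nz) b.den_nz
    apply zsmul_right_injective hne
    have hab : _ • c = _ • c := congrArg (· • c) (Rat.add_num_den' a b)
    have h₁ := hden (a + b)
    have h₂ := hden a
    have h₃ := hden b
    push_cast
    linear_combination (norm := module) hab + ((a.den : ℤ) * b.den) • h₁
      - (((a + b).den : ℤ) * b.den) • h₂ - (((a + b).den : ℤ) * a.den) • h₃
  · simpa using hd 1 one_ne_zero

/-- A sequence killed by `OmegaOp` vanishes in positive degrees. -/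
theorem OmegaOp.apply_succ_eq_zero {A : Type*} [AddCommGroup A] [IsAddTorsionFree A]
    {g : ℕ → A} (hg : OmegaOp g = 0) (n : ℕ) : g (n + 1) = 0 := by
  have hrec : ∀ n, (n + 1) • g (n + 1) + n • g n = 0 := congrFun hg
  induction n with
  | zero => simpa using hrec 0
  | succ n ih => simpa [ih] using hrec (n + 1)

/-- If `OmegaOp f` vanishes in positive degrees, its constant term is divisible by every
positive integer. -/
theorem OmegaOp.succ_nsmul_apply_succ {A : Type*} [AddCommGroup A] {f : ℕ → A}
    (hf : ∀ n, OmegaOp f (n + 1) = 0) (n : ℕ) :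
    (n + 1) • ((-1 : ℤ) ^ n • f (n + 1)) = OmegaOp f 0 := by
  induction n with
  | zero => simp [OmegaOp]
  | succ n ih =>
    have hrec : (n + 1 + 1) • f (n + 1 + 1) = -((n + 1) • f (n + 1)) :=
      eq_neg_of_add_eq_zero_left (hf n)
    rw [← ih, smul_comm, hrec, smul_comm (n + 1), pow_succ, mul_neg_one, neg_smul, smul_neg,
      neg_neg]

/-- Let `A` be a torsion-free abelian group such that every additive homomorphism
`ℚ → A` is zero. If `Ω(Ω(f)) = 0` then `Ω(f) = 0`. -/
theorem stmt_0 (A : Type) [AddCommGroup A]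
    (htf : ∀ (a : A) (n : ℕ), 0 < n → n • a = 0 → a = 0)
    (hq : ∀ φ : ℚ →+ A, φ = 0)
    (f : ℕ → A) (h : OmegaOp (OmegaOp f) = 0) :
    OmegaOp f = 0 := by
  have : IsAddTorsionFree A := ⟨fun n hn a b hab => sub_eq_zero.mp <|
    htf _ n (Nat.pos_of_ne_zero hn) (by rw [nsmul_sub, sub_eq_zero]; exact hab)⟩
  have hsucc := OmegaOp.apply_succ_eq_zero h
  obtain ⟨φ, hφ⟩ := exists_addMonoidHom_rat_of_divisible (c := OmegaOp f 0) fun n hn => by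
    obtain ⟨m, rfl⟩ := Nat.exists_eq_succ_of_ne_zero hn
    exact ⟨_, OmegaOp.succ_nsmul_apply_succ hsucc m⟩
  funext n
  cases n with
  | zero => rw [← hφ, hq φ]; rfl
  | succ n => exact hsucc n
end

section
/- Let A be an abelian group which is torsion-free and such that every additive homomorphism from ℚ to A is zero. If (f_m)_{m∈ℕ} and (g_m)_{m∈ℕ} are two families of sequences ℕ → A satisfying Ω(f_{m+1}) = f_m and Ω(g_{m+1}) = g_m for all m ∈ ℕ, and f_0 = g_0, then f_m = g_m for all m. (That is, the canonical map lim A^Ω → A[[U]] given by projection to the 0th component is injective.) -/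
/-- In a torsion-free abelian group receiving no nonzero homomorphism from `ℚ`,
the only element divisible by every positive integer is zero. -/
theorem eq_zero_of_forall_divisible {A : Type*} [AddCommGroup A]
    (htf : ∀ (a : A) (n : ℕ), 0 < n → n • a = 0 → a = 0)
    (hq : ∀ φ : ℚ →+ A, φ = 0) (c : A)
    (hc : ∀ n : ℕ, 0 < n → ∃ d : A, n • d = c) : c = 0 := by
  choose! d hd using hc
  have key (q : ℚ) : (q.den : ℤ) • (q.num • d q.den) = q.num • c := by
    rw [smul_comm, natCast_zsmul, hd _ q.den_pos]
  let φ : ℚ →+ A := AddMonoidHom.mk' (fun q => q.num • d q.den) (by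
    intro p q
    rw [← sub_eq_zero]
    refine htf _ ((p + q).den * (p.den * q.den))
      (Nat.mul_pos (p + q).den_pos (Nat.mul_pos p.den_pos q.den_pos)) ?_
    have hpq := congrArg (fun z : ℤ => z • c) (Rat.add_num_den' p q)
    have h₁ := key (p + q)
    have h₂ := key p
    have h₃ := key q
    rw [← natCast_zsmul]
    push_cast
    linear_combination (norm := module) ((p.den : ℤ) * q.den) • h₁
      - ((p + q).den * q.den : ℤ) • h₂ - ((p + q).den * p.den : ℤ) • h₃ + hpq)
  have h₁ : φ 1 = c := by
    have := hd 1 one_pos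
    simpa [φ] using this
  rw [← h₁, hq φ, AddMonoidHom.zero_apply]

theorem OmegaOp_sub {A : Type*} [AddCommGroup A] (a b : ℕ → A) :
    OmegaOp (a - b) = OmegaOp a - OmegaOp b := by
  funext n
  simp only [OmegaOp, Pi.sub_apply, smul_sub]
  abel

/-- In a torsion-free group, the kernel of `OmegaOp` consists of constant power series. -/
theorem apply_succ_eq_zero_of_OmegaOp_eq_zero {A : Type*} [AddCommGroup A]
    (htf : ∀ (a : A) (n : ℕ), 0 < n → n • a = 0 → a = 0)
    {a : ℕ → A} (ha : OmegaOp a = 0) (n : ℕ) : a (n + 1) = 0 := by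
  refine htf _ (n + 1) n.succ_pos ?_
  induction n with
  | zero => simpa [OmegaOp] using congrFun ha 0
  | succ n ih =>
    have h := congrFun ha (n + 1)
    simpa only [OmegaOp, ih, add_zero, Pi.zero_apply] using h

/-- If `(1 + U) · db/dU` is a constant power series `c`, then the coefficients of `db/dU`
are those of `c / (1 + U)`. -/
theorem succ_smul_apply_succ_of_OmegaOp_eq_const {A : Type*} [AddCommGroup A]
    {a b : ℕ → A} (hab : OmegaOp b = a) (ha : ∀ n, a (n + 1) = 0) (n : ℕ) :
    (n + 1) • b (n + 1) = (-1 : ℤ) ^ n • a 0 := by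
  induction n with
  | zero => simp [← hab, OmegaOp]
  | succ n ih =>
    have h := congrFun hab (n + 1)
    rw [ha, OmegaOp, ih] at h
    rw [eq_neg_of_add_eq_zero_left h, pow_succ, mul_neg_one, neg_smul]

theorem eq_zero_of_OmegaOp_OmegaOp_eq_zero {A : Type*} [AddCommGroup A]
    (htf : ∀ (a : A) (n : ℕ), 0 < n → n • a = 0 → a = 0)
    (hq : ∀ φ : ℚ →+ A, φ = 0)
    {b : ℕ → A} (hb : OmegaOp (OmegaOp b) = 0) : OmegaOp b = 0 := by
  have hconst := apply_succ_eq_zero_of_OmegaOp_eq_zero htf hb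
  funext n
  cases n with
  | succ n => exact hconst n
  | zero =>
    refine eq_zero_of_forall_divisible htf hq _ fun n hn => ?_
    obtain ⟨k, rfl⟩ := Nat.exists_eq_succ_of_ne_zero hn.ne'
    refine ⟨(-1 : ℤ) ^ k • b (k + 1), ?_⟩
    rw [smul_comm, Nat.succ_eq_add_one, succ_smul_apply_succ_of_OmegaOp_eq_const rfl hconst,
      smul_smul, ← mul_pow]
    simp

/-- Let `A` be a torsion-free abelian group such that every additive homomorphism
`ℚ → A` is zero.  Two elements of `lim A^Ω` (compatible families for the
transition map `Ω`) with the same 0th component are equal: the canonical map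
`lim A^Ω → A[[U]]` is injective. -/
theorem stmt_1 (A : Type) [AddCommGroup A]
    (htf : ∀ (a : A) (n : ℕ), 0 < n → n • a = 0 → a = 0)
    (hq : ∀ φ : ℚ →+ A, φ = 0)
    (f g : ℕ → ℕ → A)
    (hf : ∀ m : ℕ, OmegaOp (f (m + 1)) = f m)
    (hg : ∀ m : ℕ, OmegaOp (g (m + 1)) = g m)
    (h0 : f 0 = g 0) :
    ∀ m : ℕ, f m = g m := by
  intro m
  induction m with
  | zero => exact h0
  | succ m ih =>
    have h : OmegaOp (f (m + 2) - g (m + 2)) = f (m + 1) - g (m + 1) := by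
      rw [OmegaOp_sub, hf, hg]
    rw [← sub_eq_zero, ← h]
    refine eq_zero_of_OmegaOp_OmegaOp_eq_zero htf hq ?_
    rw [h, OmegaOp_sub, hf, hg, ih, sub_self]
end

section
/- If A is a divisible abelian group, then the operator Ω : (ℕ → A) → (ℕ → A), Ω(a)(n) = (n+1)•a(n+1) + n•a(n), is surjective. (That is, the map f ↦ (1+U)·df/dU on A[[U]] is surjective.) -/
/-- If `A` is a divisible abelian group, then the operator
`Ω : A[[U]] → A[[U]]`, `f ↦ (1+U)·df/dU`, is surjective. -/
theorem stmt_2 (A : Type) [AddCommGroup A]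
    (hdiv : ∀ (a : A) (m : ℕ), 0 < m → ∃ b : A, m • b = a) :
    Function.Surjective (OmegaOp (A := A)) := by
  intro c
  choose d hd using hdiv
  refine ⟨fun n => Nat.rec 0 (fun k x => d (c k - k • x) (k + 1) k.succ_pos) n, ?_⟩
  funext n
  simp only [OmegaOp, hd, sub_add_cancel]
end

section
/- Let A be an abelian group which is either finite or divisible. Then the additive map Φ from the product ∏_{m∈ℕ} (ℕ → A) to itself defined by Φ((f_m)_{m∈ℕ}) = (f_m − Ω(f_{m+1}))_{m∈ℕ} is surjective. (Equivalently, R¹lim A^Ω = 0, where A^Ω is the projective system with all terms A[[U]] and all transition maps Ω.) -/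
/-- Over a divisible group the operator `Ω` is surjective: solve for the coefficients one by one. -/
theorem OmegaOp_surjective_of_divisible {A : Type*} [AddCommGroup A]
    (hA : ∀ (a : A) (m : ℕ), 0 < m → ∃ b : A, m • b = a) :
    Function.Surjective (OmegaOp (A := A)) := by
  intro g
  choose d hd using fun (a : A) (n : ℕ) => hA a (n + 1) n.succ_pos
  let a : ℕ → A := fun n => Nat.rec 0 (fun k x => d (g k - k • x) k) n
  refine ⟨a, funext fun n => ?_⟩
  have h : (n + 1) • a (n + 1) = g n - n • a n := hd _ _
  simp only [OmegaOp, h, sub_add_cancel]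

/-- For an inverse sequence with constant term `B` and surjective transition map `T`, the map
`(f_m) ↦ (f_m - T f_{m+1})` is surjective. -/
theorem surjective_sub_shift_of_surjective {B : Type*} [AddCommGroup B] {T : B → B}
    (hT : Function.Surjective T) :
    Function.Surjective (fun F : ℕ → B => fun m : ℕ => F m - T (F (m + 1))) := by
  intro G
  choose s hs using hT
  let F : ℕ → B := fun m => Nat.rec 0 (fun k x => s (x - G k)) m
  refine ⟨F, funext fun m => ?_⟩
  have h : T (F (m + 1)) = F m - G m := hs _
  simp only [h, sub_sub_cancel]

/-- Finitely many of the equations `f_m - T f_{m+1} = g_m` can always be solved. -/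
theorem exists_sub_shift_eq_of_lt {B : Type*} [AddCommGroup B] (T : B → B) (M : ℕ) :
    ∀ G : ℕ → B, ∃ F : ℕ → B, ∀ m < M, F m - T (F (m + 1)) = G m := by
  induction M with
  | zero => exact fun G => ⟨G, fun m hm => absurd hm m.not_lt_zero⟩
  | succ M ih =>
    intro G
    obtain ⟨F, hF⟩ := ih fun m => G (m + 1)
    refine ⟨fun m => Nat.casesOn m (G 0 + T (F 0)) F, fun m hm => ?_⟩
    cases m with
    | zero => exact add_sub_cancel_right _ _
    | succ m => exact hF m (Nat.lt_of_succ_lt_succ hm)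

/-- For a compact Hausdorff group `B` and a continuous transition map `T`, the map
`(f_m) ↦ (f_m - T f_{m+1})` is surjective. -/
theorem surjective_sub_shift_of_compact {B : Type*} [AddCommGroup B] [TopologicalSpace B]
    [CompactSpace B] [T2Space B] [ContinuousSub B] {T : B → B} (hT : Continuous T) :
    Function.Surjective (fun F : ℕ → B => fun m : ℕ => F m - T (F (m + 1))) := by
  intro G
  let S : ℕ → Set (ℕ → B) := fun M => {F | ∀ m < M, F m - T (F (m + 1)) = G m}
  have hS : ∀ M, IsClosed (S M) := fun M => by
    simp only [S, Set.ofPred_forall]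
    exact isClosed_iInter fun m => isClosed_iInter fun _ =>
      isClosed_eq (by fun_prop) continuous_const
  obtain ⟨F, hF⟩ := IsCompact.nonempty_iInter_of_sequence_nonempty_isCompact_isClosed S
    (fun M F hF m hm => hF m (hm.trans M.lt_succ_self))
    (fun M => exists_sub_shift_eq_of_lt T M G) (hS 0).isCompact hS
  exact ⟨F, funext fun m => Set.mem_iInter.mp hF (m + 1) m m.lt_succ_self⟩

/-- Let `A` be an abelian group which is finite or divisible. Then the map
`Φ((f_m)_m) = (f_m − Ω(f_{m+1}))_m` on `∏_{m∈ℕ} A[[U]]` is surjective;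
equivalently `R¹lim A^Ω = 0`. -/
theorem stmt_6 (A : Type) [AddCommGroup A]
    (hA : Finite A ∨ ∀ (a : A) (m : ℕ), 0 < m → ∃ b : A, m • b = a) :
    Function.Surjective
      (fun F : ℕ → ℕ → A => fun m : ℕ => F m - OmegaOp (F (m + 1))) := by
  rcases hA with hfin | hdiv
  · let _ : TopologicalSpace A := ⊥
    have : DiscreteTopology A := ⟨rfl⟩
    refine surjective_sub_shift_of_compact (continuous_pi fun n => ?_)
    simp only [OmegaOp]
    fun_prop
  · exact surjective_sub_shift_of_surjective (OmegaOp_surjective_of_divisible hdiv)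
end

section
/- Let A be an abelian group. The additive group {x : ℕ → A | ∀ n ∈ ℕ, (n+1)•x(n+1) = x(n)} (the inverse limit lim A! of the projective system whose every term is A and whose transition map from level n to level n−1 is multiplication by n) is isomorphic, as an abelian group, to the group Hom(ℚ, A) of additive homomorphisms from ℚ to A. -/
/-- The inverse limit `lim A!` of the projective system whose every term is `A`
and whose transition map from level `n` to level `n−1` is multiplication by `n`,
realised as the additive subgroup of `ℕ → A` of sequences `x` with
`(n+1) • x(n+1) = x(n)` for all `n`. -/
def limFactorial (A : Type*) [AddCommGroup A] : AddSubgroup (ℕ → A) where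
  carrier := {x | ∀ n : ℕ, (n + 1) • x (n + 1) = x n}
  zero_mem' := by intro n; simp
  add_mem' := by
    intro a b ha hb n
    have : (n + 1) • (a (n + 1) + b (n + 1)) = a n + b n := by
      rw [smul_add, ha n, hb n]
    simpa using this
  neg_mem' := by
    intro a ha n
    have : (n + 1) • (-(a (n + 1))) = -(a n) := by rw [smul_neg, ha n]
    simpa using this

/-- In a sequence in `lim A!`, the `n`-th term is `(n+1)⋯(n+k)` times the `(n+k)`-th one. -/
theorem ascFactorial_smul_of_mem_limFactorial {A : Type*} [AddCommGroup A] {x : ℕ → A}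
    (hx : x ∈ limFactorial A) (n k : ℕ) : (n + 1).ascFactorial k • x (n + k) = x n := by
  induction k with
  | zero => simp
  | succ k ih =>
    rw [Nat.ascFactorial_succ, mul_comm, mul_smul, ← ih, ← hx (n + k)]
    congr 2
    ring

/-- The value `a • x n` depends only on the rational number `a / n!`. -/
theorem zsmul_eq_zsmul_of_div_factorial_eq {A : Type*} [AddCommGroup A] {x : ℕ → A}
    (hx : x ∈ limFactorial A) {a b : ℤ} {n m : ℕ}
    (h : (a : ℚ) / n.factorial = b / m.factorial) : a • x n = b • x m := by
  wlog hnm : n ≤ m generalizing a b n m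
  · exact (this h.symm (le_of_not_ge hnm)).symm
  obtain ⟨k, rfl⟩ := Nat.exists_eq_add_of_le hnm
  have hn : (n.factorial : ℚ) ≠ 0 := by exact_mod_cast n.factorial_ne_zero
  have hk : ((n + k).factorial : ℚ) ≠ 0 := by exact_mod_cast (n + k).factorial_ne_zero
  have hb : a * ((n + 1).ascFactorial k : ℤ) = b := by
    rw [div_eq_div_iff hn hk, ← Nat.factorial_mul_ascFactorial] at h
    push_cast at h
    have : (a : ℚ) * ((n + 1).ascFactorial k : ℚ) = b := by
      apply mul_right_cancel₀ hn
      linear_combination h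
    exact_mod_cast this
  rw [← ascFactorial_smul_of_mem_limFactorial hx n k, ← hb, mul_smul, natCast_zsmul]

/-- If the denominator of `q` is at most `n`, then `q` is an integer multiple of `1 / n!`. -/
theorem Rat.exists_eq_intCast_div_factorial (q : ℚ) {n : ℕ} (hn : q.den ≤ n) :
    ∃ a : ℤ, q = a / n.factorial := by
  obtain ⟨c, hc⟩ := Nat.dvd_factorial q.den_pos hn
  have h0 : (n.factorial : ℚ) ≠ 0 := by exact_mod_cast n.factorial_ne_zero
  refine ⟨q.num * c, ?_⟩
  rw [eq_div_iff h0, hc]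
  push_cast
  rw [← mul_assoc, Rat.mul_den_eq_num]

/-- The homomorphism `ℚ → A` attached to a sequence in `lim A!`, sending `a / n!` to `a • x n`. -/
noncomputable def limFactorialToHom {A : Type*} [AddCommGroup A] (x : limFactorial A) :
    ℚ →+ A :=
  AddMonoidHom.mk'
    (fun q => (q.exists_eq_intCast_div_factorial le_rfl).choose • x.1 q.den) <| by
    intro q r
    obtain ⟨a, ha⟩ := q.exists_eq_intCast_div_factorial (Nat.le_add_right q.den r.den)
    obtain ⟨b, hb⟩ := r.exists_eq_intCast_div_factorial (Nat.le_add_left r.den q.den)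
    have hab : q + r = ((a + b : ℤ) : ℚ) / (q.den + r.den).factorial := by
      rw [Int.cast_add, add_div, ← ha, ← hb]
    have key (s : ℚ) {c : ℤ} {n : ℕ} (hs : s = c / n.factorial) :
        (s.exists_eq_intCast_div_factorial le_rfl).choose • x.1 s.den = c • x.1 n :=
      zsmul_eq_zsmul_of_div_factorial_eq x.2
        ((s.exists_eq_intCast_div_factorial le_rfl).choose_spec.symm.trans hs)
    rw [key _ ha, key _ hb, key _ hab, add_smul]

theorem limFactorialToHom_intCast_div_factorial {A : Type*} [AddCommGroup A]
    (x : limFactorial A) (a : ℤ) (n : ℕ) :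
    limFactorialToHom x ((a : ℚ) / n.factorial) = a • x.1 n :=
  zsmul_eq_zsmul_of_div_factorial_eq x.2
    (Rat.exists_eq_intCast_div_factorial _ le_rfl).choose_spec.symm

/-- The isomorphism `Hom(ℚ, A) ≃ lim A!` sending `f` to the sequence `n ↦ f (1 / n!)`. -/
noncomputable def homEquivLimFactorial (A : Type*) [AddCommGroup A] :
    (ℚ →+ A) ≃+ limFactorial A where
  toFun f := ⟨fun n => f (1 / n.factorial), fun n => by
    have h0 : (n.factorial : ℚ) ≠ 0 := by exact_mod_cast n.factorial_ne_zero
    have h1 : (n + 1 : ℚ) ≠ 0 := by positivity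
    rw [← map_nsmul, Nat.factorial_succ, nsmul_eq_mul]
    congr 1
    push_cast
    field_simp⟩
  invFun := limFactorialToHom
  left_inv f := by
    ext q
    obtain ⟨a, ha⟩ := q.exists_eq_intCast_div_factorial le_rfl
    rw [ha, limFactorialToHom_intCast_div_factorial, ← map_zsmul, zsmul_eq_mul, mul_one_div]
  right_inv x := by
    ext n
    simpa using limFactorialToHom_intCast_div_factorial x 1 n
  map_add' _ _ := rfl


/-- Let `A` be an abelian group. The group `lim A!` is isomorphic, as an abelian
group, to `Hom(ℚ, A)`. -/
theorem stmt_12 (A : Type) [AddCommGroup A] :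
    Nonempty (limFactorial A ≃+ (ℚ →+ A)) := by
  exact ⟨(homEquivLimFactorial A).symm⟩
end

section
/- Let A be an abelian group. The cokernel of the additive map Φ : (ℕ → A) → (ℕ → A) defined by Φ(x)(n) = x(n) − (n+1)•x(n+1) (which computes R¹lim of the projective system A!) is isomorphic, as an abelian group, to Ext¹_ℤ(ℚ, A), the first Ext group of ℚ and A in the category of ℤ-modules. -/
open CategoryTheory

/-- The map `Φ : ∏_{n∈ℕ} A → ∏_{n∈ℕ} A`, `Φ(x)(n) = x(n) − (n+1)•x(n+1)`, whose
cokernel computes `R¹lim` of the projective system `A!` (all terms `A`,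
transition map from level `n` to level `n−1` given by multiplication by `n`). -/
def PhiFactorial (A : Type*) [AddCommGroup A] : (ℕ → A) →+ (ℕ → A) where
  toFun x := fun n => x n - (n + 1) • x (n + 1)
  map_zero' := by funext n; simp
  map_add' := by
    intro a b
    funext n
    simp [smul_add]
    abel

namespace CategoryTheory

open Limits ZeroObject

namespace ShortComplex

variable {C : Type*} [Category* C] [Abelian C] (S : ShortComplex C)

/-- The objects of the chain complex `⋯ ⟶ 0 ⟶ S.X₁ ⟶ S.X₂`. -/
noncomputable def twoTermX : ℕ → C
  | 0 => S.X₂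
  | 1 => S.X₁
  | _ + 2 => 0

/-- The differentials of the chain complex `⋯ ⟶ 0 ⟶ S.X₁ ⟶ S.X₂`. -/
noncomputable def twoTermD : (n : ℕ) → (S.twoTermX (n + 1) ⟶ S.twoTermX n)
  | 0 => S.f
  | _ + 1 => 0

/-- The chain complex `⋯ ⟶ 0 ⟶ S.X₁ ⟶ S.X₂`, with `S.X₂` in degree `0`. -/
noncomputable def twoTerm : ChainComplex C ℕ :=
  ChainComplex.of S.twoTermX S.twoTermD (fun _ => zero_comp)

lemma twoTerm_d_one_zero : S.twoTerm.d 1 0 = S.f :=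
  ChainComplex.of_d S.twoTermX S.twoTermD 0

lemma isZero_twoTerm_X (n : ℕ) : IsZero (S.twoTerm.X (n + 2)) :=
  isZero_zero C

variable {S}

lemma ShortExact.twoTerm_exactAt_succ (hS : S.ShortExact) (n : ℕ) :
    S.twoTerm.ExactAt (n + 1) := by
  have := hS.mono_f
  cases n with
  | zero =>
    rw [HomologicalComplex.exactAt_iff' _ 2 1 0 (by simp) (by simp)]
    refine (ShortComplex.exact_iff_mono _ ?_).2 ?_
    · exact (S.isZero_twoTerm_X 0).eq_of_src _ _
    · change Mono (S.twoTerm.d 1 0)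
      rwa [twoTerm_d_one_zero]
  | succ n => exact .of_isZero (S.isZero_twoTerm_X n)

/-- A short exact sequence `0 ⟶ X₁ ⟶ X₂ ⟶ X₃ ⟶ 0` with `X₁` and `X₂` projective gives a
projective resolution of `X₃`. -/
noncomputable def ShortExact.projectiveResolution (hS : S.ShortExact)
    [h₁ : Projective S.X₁] [h₂ : Projective S.X₂] : ProjectiveResolution S.X₃ where
  complex := S.twoTerm
  projective
    | 0 => h₂
    | 1 => h₁
    | n + 2 => (S.isZero_twoTerm_X n).projective
  π := (ChainComplex.toSingle₀Equiv _ _).symm ⟨S.g, by rw [twoTerm_d_one_zero]; exact S.zero⟩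
  quasiIso := ⟨fun n => by
    cases n
    · rw [ChainComplex.quasiIsoAt₀_iff, ShortComplex.quasiIso_iff_of_zeros']
      · refine (ShortComplex.exact_and_epi_g_iff_of_iso ?_).2 ⟨hS.exact, hS.epi_g⟩
        exact ShortComplex.isoMk (Iso.refl _) (Iso.refl _) (Iso.refl _)
          ((Category.id_comp S.f).trans
            (S.twoTerm_d_one_zero.symm.trans (Category.comp_id _).symm))
          ((Category.id_comp S.g).trans
            ((ChainComplex.toSingle₀Equiv_symm_apply_f_zero (C := S.twoTerm) S.g _).symm.trans
              (Category.comp_id _).symm))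
      all_goals rfl
    · rw [quasiIsoAt_iff_exactAt']
      · exact hS.twoTerm_exactAt_succ _
      · apply ChainComplex.exactAt_succ_single_obj⟩

/-- If `0 ⟶ X₁ ⟶ X₂ ⟶ X₃ ⟶ 0` is exact with `X₁` and `X₂` projective, then `Ext¹(X₃, Y)` is the
cokernel of `Hom(X₂, Y) ⟶ Hom(X₁, Y)`. -/
lemma ShortExact.exists_hom_to_ext_one {R : Type*} [Ring R] [Linear R C] [EnoughProjectives C]
    (hS : S.ShortExact) [Projective S.X₁] [Projective S.X₂] (Y : C) :
    ∃ ψ : (S.X₁ ⟶ Y) →+ ((Ext R C 1).obj (Opposite.op S.X₃)).obj Y,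
      Function.Surjective ψ ∧ ∀ f, ψ f = 0 ↔ ∃ g : S.X₂ ⟶ Y, S.f ≫ g = f := by
  let P := hS.projectiveResolution
  let K := P.complex.linearYonedaObj R Y
  have h12 : K.d 1 2 = 0 := by
    ext x
    exact (S.isZero_twoTerm_X 0).eq_of_src _ _
  let e := K.isoHomologyι 1 2 (by simp) h12
  let i := P.isoExt (R := R) 1 Y
  let j := K.opcyclesIsoSc' 0 1 2 (by simp) (by simp)
  let L := (e ≪≫ j).symm ≪≫ i.symm
  let ψ : (K.sc' 0 1 2).X₂ ⟶ _ := (K.sc' 0 1 2).pOpcycles ≫ L.hom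
  refine ⟨ψ.hom.toAddMonoidHom, ?_, fun f => ?_⟩
  · exact (ModuleCat.epi_iff_surjective ψ).1 inferInstance
  · have h1 : ψ.hom f = 0 ↔ (K.sc' 0 1 2).pOpcycles.hom f = 0 :=
      map_eq_zero_iff L.hom.hom ((ModuleCat.mono_iff_injective L.hom).1 inferInstance)
    refine h1.trans (((K.sc' 0 1 2).moduleCat_pOpcycles_eq_zero_iff f).trans ?_)
    change (∃ g : S.X₂ ⟶ Y, S.twoTerm.d 1 0 ≫ g = f) ↔ _
    rw [twoTerm_d_one_zero]
    rfl

end ShortComplex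

end CategoryTheory

namespace Rat

/-- The differential `eₙ ↦ eₙ - (n + 1) eₙ₊₁` of the free resolution of `ℚ` whose augmentation is
`Rat.factorialAug`. -/
noncomputable def factorialD : (ℕ →₀ ℤ) →ₗ[ℤ] (ℕ →₀ ℤ) :=
  Finsupp.linearCombination ℤ fun n => .single n 1 - (n + 1) • .single (n + 1) 1

/-- The augmentation `eₙ ↦ 1 / n!`. -/
noncomputable def factorialAug : (ℕ →₀ ℤ) →ₗ[ℤ] ℚ :=
  Finsupp.linearCombination ℤ fun n => (n.factorial : ℚ)⁻¹

lemma factorialAug_single (n : ℕ) (a : ℤ) : factorialAug (.single n a) = a / n.factorial := by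
  simp [factorialAug, div_eq_mul_inv]

lemma factorialD_single (n : ℕ) :
    factorialD (.single n 1) = .single n 1 - (n + 1) • .single (n + 1) 1 := by
  simp [factorialD]

lemma factorialAug_comp_factorialD : factorialAug ∘ₗ factorialD = 0 := by
  ext n
  have h : (n + 1 : ℚ) ≠ 0 := by positivity
  simp only [LinearMap.comp_apply, Finsupp.lsingle_apply, factorialD_single, map_sub, map_nsmul,
    factorialAug_single, Nat.factorial_succ]
  push_cast
  simp only [nsmul_eq_mul, LinearMap.zero_apply]
  push_cast
  field_simp
  simp

lemma factorialD_apply_zero (x : ℕ →₀ ℤ) : factorialD x 0 = x 0 := by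
  suffices Finsupp.lapply 0 ∘ₗ factorialD = Finsupp.lapply 0 from LinearMap.congr_fun this x
  ext n
  simp [factorialD]

lemma factorialD_apply_succ (x : ℕ →₀ ℤ) (m : ℕ) :
    factorialD x (m + 1) = x (m + 1) - (m + 1) * x m := by
  suffices Finsupp.lapply (m + 1) ∘ₗ factorialD =
      Finsupp.lapply (m + 1) - ((m : ℤ) + 1) • Finsupp.lapply m from LinearMap.congr_fun this x
  ext n
  by_cases h : n = m <;> simp [factorialD, h, Finsupp.single_apply]

lemma factorialD_injective : Function.Injective factorialD := by
  rw [injective_iff_map_eq_zero]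
  intro x hx
  ext n
  induction n with
  | zero => rw [← factorialD_apply_zero, hx]
  | succ n ih => simpa [ih, hx] using (factorialD_apply_succ x n).symm

lemma factorialAug_surjective : Function.Surjective factorialAug := by
  intro q
  refine ⟨.single q.den (q.num * (q.den - 1).factorial : ℤ), ?_⟩
  have h : ((q.den - 1).factorial : ℚ) ≠ 0 := by positivity
  have h' : (q.den : ℚ) ≠ 0 := by simp
  conv_rhs => rw [← Rat.num_div_den q]
  rw [factorialAug_single, ← Nat.mul_factorial_pred q.den_ne_zero]
  push_cast
  field_simp

lemma exists_single_sub_smul_single_mem_range (n k : ℕ) :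
    ∃ c : ℤ, Finsupp.single n 1 - c • Finsupp.single (n + k) 1 ∈ LinearMap.range factorialD := by
  induction k with
  | zero => exact ⟨1, by simp⟩
  | succ k ih =>
    obtain ⟨c, hc⟩ := ih
    refine ⟨c * (n + k + 1), ?_⟩
    convert add_mem hc (Submodule.smul_mem _ c (LinearMap.mem_range_self _ (.single (n + k) 1)))
      using 1
    rw [factorialD_single, ← add_assoc]
    module

lemma exists_sub_smul_single_mem_range (x : ℕ →₀ ℤ) :
    ∃ N : ℕ, ∀ M, N ≤ M →
      ∃ c : ℤ, x - c • Finsupp.single M 1 ∈ LinearMap.range factorialD := by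
  induction x using Finsupp.induction_linear with
  | zero => exact ⟨0, fun M _ => ⟨0, by simp⟩⟩
  | add x y hx hy =>
    obtain ⟨N, hN⟩ := hx
    obtain ⟨N', hN'⟩ := hy
    refine ⟨max N N', fun M hM => ?_⟩
    obtain ⟨c, hc⟩ := hN M (by omega)
    obtain ⟨c', hc'⟩ := hN' M (by omega)
    refine ⟨c + c', ?_⟩
    convert add_mem hc hc' using 1
    module
  | single n a =>
    refine ⟨n, fun M hM => ?_⟩
    obtain ⟨k, rfl⟩ := Nat.exists_eq_add_of_le hM
    obtain ⟨c, hc⟩ := exists_single_sub_smul_single_mem_range n k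
    refine ⟨a * c, ?_⟩
    convert Submodule.smul_mem _ a hc using 1
    rw [smul_sub, mul_smul, Finsupp.smul_single_one n a]

lemma exact_factorialD_factorialAug : Function.Exact factorialD factorialAug := by
  rw [LinearMap.exact_iff]
  refine le_antisymm (fun x hx => ?_)
    (LinearMap.range_le_ker_iff.2 factorialAug_comp_factorialD)
  obtain ⟨N, hN⟩ := exists_sub_smul_single_mem_range x
  obtain ⟨c, hc⟩ := hN N le_rfl
  have h := LinearMap.range_le_ker_iff.2 factorialAug_comp_factorialD hc
  rw [LinearMap.mem_ker] at h hx
  rw [map_sub, hx, Finsupp.smul_single_one, factorialAug_single] at h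
  have hc0 : c = 0 := by simpa [Nat.factorial_ne_zero] using h
  simpa [hc0] using hc

end Rat

/-- Let `A` be an abelian group. The cokernel of `Φ` (i.e. `R¹lim A!`) is
isomorphic, as an abelian group, to `Ext¹_ℤ(ℚ, A)`. -/
theorem stmt_13 (A : Type) [AddCommGroup A] :
    Nonempty (((ℕ → A) ⧸ (PhiFactorial A).range) ≃+
      (((Ext ℤ (ModuleCat ℤ) 1).obj (Opposite.op (ModuleCat.of ℤ ℚ))).obj
        (ModuleCat.of ℤ A))) := by
  let S : ShortComplex (ModuleCat ℤ) :=
    .moduleCatMk Rat.factorialD Rat.factorialAug Rat.factorialAug_comp_factorialD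
  have hS : S.ShortExact := ModuleCat.shortComplex_shortExact S
    Rat.exact_factorialD_factorialAug Rat.factorialD_injective Rat.factorialAug_surjective
  have : Projective S.X₁ := ModuleCat.projective_of_free (M := ModuleCat.of ℤ (ℕ →₀ ℤ))
    Finsupp.basisSingleOne
  have : Projective S.X₂ := this
  obtain ⟨ψ, hψ, hker⟩ := hS.exists_hom_to_ext_one (R := ℤ) (ModuleCat.of ℤ A)
  let e : (ℕ → A) ≃+ (S.X₁ ⟶ ModuleCat.of ℤ A) :=
    (Finsupp.lift A ℤ ℕ).trans
      (ModuleCat.homAddEquiv (M := ModuleCat.of ℤ (ℕ →₀ ℤ)) (N := ModuleCat.of ℤ A)).symm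
  have he : ∀ x, e (PhiFactorial A x) = S.f ≫ e x := by
    intro x
    apply ModuleCat.hom_ext
    change Finsupp.lift A ℤ ℕ (PhiFactorial A x) = (Finsupp.lift A ℤ ℕ x) ∘ₗ Rat.factorialD
    have hx (m : ℕ) : Finsupp.lift A ℤ ℕ x (.single m 1) = x m := by simp
    ext n
    simp only [LinearMap.comp_apply, Finsupp.lsingle_apply, Rat.factorialD_single, map_sub,
      map_nsmul, hx]
    simp [PhiFactorial]
  let φ : (ℕ → A) →+ _ := ψ.comp e.toAddMonoidHom
  have hφ : (PhiFactorial A).range = φ.ker := by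
    ext x
    refine Iff.trans ?_ (hker (e x)).symm
    constructor
    · rintro ⟨y, rfl⟩
      exact ⟨e y, (he y).symm⟩
    · rintro ⟨g, hg⟩
      refine ⟨e.symm g, e.injective ?_⟩
      rw [he, ← hg]
      exact congrArg (S.f ≫ ·) (e.apply_symm_apply g)
  exact ⟨(QuotientAddGroup.quotientAddEquivOfEq hφ).trans
    (QuotientAddGroup.quotientKerEquivOfSurjective φ (hψ.comp e.surjective))⟩
end
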